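/- arXiv:2501.00565 — 2 statements merged into one kernel-verified Lean document; each statement's English description precedes it below -/
import Mathlib

section
/- Let d ≥ 1 and let V : ℝ^d → ℝ be C² with Z_V := ∫_{ℝ^d} e^{−V(x)} dx < ∞, satisfying ∇²V(x) ⪯ β I_d for all x (β ≥ 0) and ⟨∇V(x), x⟩ ≥ a‖x‖² − b for all x (a > 0, b ≥ 0). Then for all x ∈ ℝ^d, V(x) − V(0) ≥ a‖x‖²/4 − b(β/a + (log 2)/2), and consequently the density μ = e^{−V}/Z_V satisfies μ(0) ≥ e^{−b(β/a + (log 2)/2)} (a/(4π))^{d/2}. -/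
open Real MeasureTheory
open scoped RealInnerProductSpace

/-- The derivative of `t ↦ V (x + t • v)`. -/
theorem hasDerivAt_comp_add_smul {E F : Type*} [NormedAddCommGroup E] [NormedSpace ℝ E]
    [NormedAddCommGroup F] [NormedSpace ℝ F] {V : E → F} (hV : Differentiable ℝ V)
    (x v : E) (t : ℝ) :
    HasDerivAt (fun s : ℝ => V (x + s • v)) (fderiv ℝ V (x + t • v) v) t := by
  have h : HasDerivAt (fun s : ℝ => x + s • v) v t := by
    simpa using ((hasDerivAt_id t).smul_const v).const_add x
  exact (hV (x + t • v)).hasFDerivAt.comp_hasDerivAt t h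

/-- Quadratic upper bound for a function whose Hessian is at most `β`, at a critical point. -/
theorem le_add_sq_norm_of_fderiv_eq_zero {E : Type*} [NormedAddCommGroup E] [NormedSpace ℝ E]
    {V : E → ℝ} (hV : ContDiff ℝ 2 V) {β : ℝ}
    (hhess : ∀ x v : E, iteratedFDeriv ℝ 2 V x ![v, v] ≤ β * ‖v‖ ^ 2)
    {x : E} (hx : fderiv ℝ V x = 0) (v : E) :
    V (x + v) ≤ V x + β * ‖v‖ ^ 2 / 2 := by
  have hV1 : Differentiable ℝ V := hV.differentiable (by norm_num)
  have hV2 : Differentiable ℝ (fderiv ℝ V) :=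
    (hV.fderiv_right (m := 1) (by norm_num)).differentiable (by norm_num)
  have hd2 : ∀ t : ℝ, HasDerivAt (fun s : ℝ => fderiv ℝ V (x + s • v) v - β * ‖v‖ ^ 2 * s)
      (iteratedFDeriv ℝ 2 V (x + t • v) ![v, v] - β * ‖v‖ ^ 2) t := by
    intro t
    have h := (hasDerivAt_comp_add_smul hV2 x v t).clm_apply (hasDerivAt_const t v)
    refine (h.sub ((hasDerivAt_id t).const_mul (β * ‖v‖ ^ 2))).congr_deriv ?_
    simp [iteratedFDeriv_two_apply]
  have hanti := antitone_of_hasDerivAt_nonpos hd2 fun t => sub_nonpos.2 (hhess _ _)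
  have hd1 : ∀ t : ℝ, HasDerivAt (fun s : ℝ => V (x + s • v) - β * ‖v‖ ^ 2 / 2 * s ^ 2)
      (fderiv ℝ V (x + t • v) v - β * ‖v‖ ^ 2 * t) t := by
    intro t
    refine ((hasDerivAt_comp_add_smul hV1 x v t).sub
      ((hasDerivAt_pow 2 t).const_mul (β * ‖v‖ ^ 2 / 2))).congr_deriv ?_
    simp; ring
  have hmono : AntitoneOn (fun s : ℝ => V (x + s • v) - β * ‖v‖ ^ 2 / 2 * s ^ 2) (Set.Ici 0) := by
    refine antitoneOn_of_hasDerivWithinAt_nonpos (convex_Ici 0)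
      (fun t _ => (hd1 t).continuousAt.continuousWithinAt)
      (fun t _ => (hd1 t).hasDerivWithinAt) fun t ht => ?_
    rw [interior_Ici] at ht
    simpa [hx] using hanti (le_of_lt ht)
  have := hmono (Set.mem_Ici.2 le_rfl) (Set.mem_Ici.2 zero_le_one) zero_le_one
  simp only [one_smul, zero_smul, add_zero] at this
  linarith

section Dissipative

variable {E : Type*} [NormedAddCommGroup E] [InnerProductSpace ℝ E] [CompleteSpace E]
  {V : E → ℝ} {a b : ℝ}

/-- Radial growth of a dissipative potential. -/
theorem radial_growth_of_dissipative (hV : Differentiable ℝ V)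
    (hdiss : ∀ x : E, a * ‖x‖ ^ 2 - b ≤ ⟪gradient V x, x⟫) (x : E) {s : ℝ} (hs : 0 < s)
    (hs1 : s ≤ 1) :
    a * ‖x‖ ^ 2 / 2 * (1 - s ^ 2) + b * Real.log s ≤ V x - V (s • x) := by
  have hd : ∀ t : ℝ, 0 < t →
      HasDerivAt (fun t : ℝ => V (0 + t • x) - a * ‖x‖ ^ 2 / 2 * t ^ 2 + b * Real.log t)
        (fderiv ℝ V (0 + t • x) x - a * ‖x‖ ^ 2 * t + b * t⁻¹) t := by
    intro t ht
    refine (((hasDerivAt_comp_add_smul hV 0 x t).sub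
      ((hasDerivAt_pow 2 t).const_mul (a * ‖x‖ ^ 2 / 2))).add
      ((Real.hasDerivAt_log ht.ne').const_mul b)).congr_deriv ?_
    simp; ring
  have hmono : MonotoneOn
      (fun t : ℝ => V (0 + t • x) - a * ‖x‖ ^ 2 / 2 * t ^ 2 + b * Real.log t) (Set.Ioi 0) := by
    refine monotoneOn_of_hasDerivWithinAt_nonneg (convex_Ioi 0)
      (fun t ht => (hd t ht).continuousAt.continuousWithinAt)
      (fun t ht => (hd t (interior_subset ht)).hasDerivWithinAt) fun t ht => ?_
    have ht : 0 < t := interior_subset ht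
    have h := hdiss (t • x)
    rw [gradient, InnerProductSpace.toDual_symm_apply, map_smul, smul_eq_mul, norm_smul,
      mul_pow, Real.norm_eq_abs, sq_abs] at h
    rw [zero_add]
    refine nonneg_of_mul_nonneg_right (a := t) ?_ ht
    have : t * (b * t⁻¹) = b := by field_simp
    nlinarith
  have := hmono (Set.mem_Ioi.2 hs) (Set.mem_Ioi.2 one_pos) hs1
  simp only [one_smul, zero_add, Real.log_one] at this
  linarith

/-- A dissipative potential attains its minimum, in the ball of radius `√(b / a)`. -/
theorem exists_isMin_of_dissipative [FiniteDimensional ℝ E] (hV : Differentiable ℝ V)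
    (ha : 0 < a) (hb : 0 ≤ b)
    (hdiss : ∀ x : E, a * ‖x‖ ^ 2 - b ≤ ⟪gradient V x, x⟫) :
    ∃ z : E, a * ‖z‖ ^ 2 ≤ b ∧ ∀ x, V z ≤ V x := by
  have hR : 0 ≤ √(b / a) := Real.sqrt_nonneg _
  have hRsq : a * √(b / a) ^ 2 = b := by rw [Real.sq_sqrt (by positivity)]; field_simp
  obtain ⟨z, hz, hmin⟩ := (isCompact_closedBall (0 : E) √(b / a)).exists_isMinOn
    ⟨0, by simp⟩ hV.continuous.continuousOn
  rw [mem_closedBall_zero_iff] at hz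
  refine ⟨z, ?_, fun x => ?_⟩
  · rw [← hRsq]; gcongr
  rcases le_or_gt ‖x‖ √(b / a) with hx | hx
  · exact hmin (mem_closedBall_zero_iff.2 hx)
  have hx0 : 0 < ‖x‖ := hR.trans_lt hx
  have hmono : MonotoneOn (fun t : ℝ => V (0 + t • x)) (Set.Ici (√(b / a) / ‖x‖)) := by
    refine monotoneOn_of_hasDerivWithinAt_nonneg (convex_Ici _)
      (fun t _ => (hasDerivAt_comp_add_smul hV 0 x t).continuousAt.continuousWithinAt)
      (fun t _ => (hasDerivAt_comp_add_smul hV 0 x t).hasDerivWithinAt) fun t ht => ?_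
    rw [interior_Ici, Set.mem_Ioi] at ht
    have ht0 : 0 < t := lt_of_le_of_lt (by positivity) ht
    rw [div_lt_iff₀ hx0] at ht
    have h := hdiss (t • x)
    rw [gradient, InnerProductSpace.toDual_symm_apply, map_smul, smul_eq_mul, norm_smul,
      Real.norm_eq_abs, abs_of_pos ht0] at h
    rw [zero_add]
    refine nonneg_of_mul_nonneg_right (a := t) (le_trans ?_ h) ht0
    rw [sub_nonneg, ← hRsq]
    gcongr
  have h1 : √(b / a) / ‖x‖ ≤ 1 := (div_le_one hx0).2 hx.le
  have h := hmono (Set.mem_Ici.2 le_rfl) (Set.mem_Ici.2 h1) h1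
  simp only [one_smul, zero_add] at h
  refine le_trans (hmin (mem_closedBall_zero_iff.2 ?_)) h
  rw [norm_smul, Real.norm_of_nonneg (by positivity), div_mul_cancel₀ _ hx0.ne']

end Dissipative


/-- If `V : ℝ^d → ℝ` is `C²` with `∫ e^{-V} < ∞`, `β`-semi-log-convex and
`(a,b)`-dissipative, then `V(x) - V(0) ≥ a‖x‖²/4 - b(β/a + (log 2)/2)` for all `x`, and
consequently the density `μ = e^{-V}/Z_V` satisfies
`μ(0) ≥ e^{-b(β/a + (log 2)/2)} (a/(4π))^{d/2}`. -/
theorem potential_lower_bound_and_density_at_zero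
    (d : ℕ) (hd : 1 ≤ d) (V : EuclideanSpace ℝ (Fin d) → ℝ)
    (hV : ContDiff ℝ 2 V)
    (hint : Integrable fun x : EuclideanSpace ℝ (Fin d) => exp (-V x))
    (β : ℝ) (hβ : 0 ≤ β)
    (hhess : ∀ x v : EuclideanSpace ℝ (Fin d),
      iteratedFDeriv ℝ 2 V x ![v, v] ≤ β * ‖v‖ ^ 2)
    (a b : ℝ) (ha : 0 < a) (hb : 0 ≤ b)
    (hdiss : ∀ x : EuclideanSpace ℝ (Fin d), a * ‖x‖ ^ 2 - b ≤ ⟪gradient V x, x⟫) :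
    (∀ x : EuclideanSpace ℝ (Fin d),
      a * ‖x‖ ^ 2 / 4 - b * (β / a + Real.log 2 / 2) ≤ V x - V 0) ∧
    exp (-(b * (β / a + Real.log 2 / 2))) * (a / (4 * π)) ^ ((d : ℝ) / 2) ≤
      exp (-V 0) / ∫ y : EuclideanSpace ℝ (Fin d), exp (-V y) := by
  have hV1 : Differentiable ℝ V := hV.differentiable (by norm_num)
  have hpot : ∀ x : EuclideanSpace ℝ (Fin d),
      a * ‖x‖ ^ 2 / 4 - b * (β / a + Real.log 2 / 2) ≤ V x - V 0 := by
    intro x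
    obtain ⟨z, hz, hmin⟩ := exists_isMin_of_dissipative hV1 ha hb hdiss
    have hcrit : fderiv ℝ V z = 0 :=
      IsLocalMin.fderiv_eq_zero (Filter.Eventually.of_forall hmin)
    have h0 := le_add_sq_norm_of_fderiv_eq_zero hV hhess hcrit (-z)
    rw [add_neg_cancel, norm_neg] at h0
    have hβz : β * ‖z‖ ^ 2 ≤ b * (β / a) := by
      have : ‖z‖ ^ 2 ≤ b / a := by rw [le_div_iff₀ ha]; linarith
      calc β * ‖z‖ ^ 2 ≤ β * (b / a) := by gcongr
        _ = b * (β / a) := by ring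
    have hgrow := radial_growth_of_dissipative hV1 hdiss x (s := (√2)⁻¹) (by positivity)
      (inv_le_one_of_one_le₀ (Real.one_le_sqrt.2 one_le_two))
    rw [inv_pow, Real.sq_sqrt zero_le_two, Real.log_inv, Real.log_sqrt zero_le_two] at hgrow
    have hnn : 0 ≤ β * ‖z‖ ^ 2 := by positivity
    linarith [hmin ((√2)⁻¹ • x)]
  refine ⟨hpot, ?_⟩
  set C := b * (β / a + Real.log 2 / 2)
  have hgauss := GaussianFourier.integral_rexp_neg_mul_sq_norm
    (V := EuclideanSpace ℝ (Fin d)) (b := a / 4) (by positivity)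
  rw [finrank_euclideanSpace_fin] at hgauss
  have hgi : Integrable fun x : EuclideanSpace ℝ (Fin d) => exp (-(a / 4) * ‖x‖ ^ 2) :=
    Integrable.of_integral_ne_zero (by rw [hgauss]; positivity)
  have hZ : ∫ y, exp (-V y) ≤ exp (C - V 0) * (π / (a / 4)) ^ ((d : ℝ) / 2) := by
    rw [← hgauss, ← integral_const_mul]
    refine integral_mono hint (hgi.const_mul _) fun y => ?_
    simp only
    rw [← Real.exp_add]
    exact Real.exp_le_exp.2 (by linarith [hpot y])
  rw [le_div_iff₀ (integral_exp_pos hint)]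
  calc exp (-C) * (a / (4 * π)) ^ ((d : ℝ) / 2) * ∫ y, exp (-V y)
      ≤ exp (-C) * (a / (4 * π)) ^ ((d : ℝ) / 2) *
        (exp (C - V 0) * (π / (a / 4)) ^ ((d : ℝ) / 2)) := by gcongr
    _ = (exp (-C) * exp (C - V 0)) *
        ((a / (4 * π)) * (π / (a / 4))) ^ ((d : ℝ) / 2) := by
      rw [Real.mul_rpow (by positivity) (by positivity)]; ring
    _ = exp (-V 0) := by
      have h1 : a / (4 * π) * (π / (a / 4)) = 1 := by field_simp
      rw [h1, Real.one_rpow, mul_one, ← Real.exp_add]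
      congr 1; ring
end

section
/- Let d ≥ 1 and let V : ℝ^d → ℝ be C² with Z_V := ∫ e^{−V} < ∞, Z_{2V} := ∫ e^{−2V} < ∞, ∇²V(x) ⪯ β I_d for all x (β ≥ 0), and finite second moment ∫ ‖x‖² e^{−V(x)}/Z_V dx < ∞. Let p_t^V (resp. p_t^{2V}) be the forward Ornstein–Uhlenbeck density started at μ = e^{−V}/Z_V (resp. at μ² = e^{−2V}/Z_{2V}), and let Φ_t := p_t^{2V}/p_t^V. Then for all t > 0, m_0(Φ_t) := ∫_{ℝ^d} Φ_t(z) dz ≤ (Z_V²/Z_{2V}) · e^{td} · (β(1−e^{−2t}) + e^{−2t})^d. -/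
open Real MeasureTheory
open scoped RealInnerProductSpace

/-- The forward Ornstein–Uhlenbeck density at time `t`, started at `μ = e^{-W}/∫ e^{-W}`. -/
noncomputable def ouDensity (d : ℕ) (W : EuclideanSpace ℝ (Fin d) → ℝ) (t : ℝ)
    (z : EuclideanSpace ℝ (Fin d)) : ℝ :=
  (2 * π * (1 - exp (-2 * t))) ^ (-(d : ℝ) / 2) *
    ∫ x : EuclideanSpace ℝ (Fin d),
      exp (-‖z - exp (-t) • x‖ ^ 2 / (2 * (1 - exp (-2 * t)))) *
        (exp (-W x) / ∫ y : EuclideanSpace ℝ (Fin d), exp (-W y))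

/-- A `C²` function with Hessian at most `β` lies below its quadratic Taylor model. -/
theorem le_quadratic_of_iteratedFDeriv_two_le {E : Type*} [NormedAddCommGroup E]
    [NormedSpace ℝ E] {V : E → ℝ} (hV : ContDiff ℝ 2 V) {β : ℝ}
    (hhess : ∀ x v : E, iteratedFDeriv ℝ 2 V x ![v, v] ≤ β * ‖v‖ ^ 2) (x u : E) :
    V (x + u) ≤ V x + fderiv ℝ V x u + β / 2 * ‖u‖ ^ 2 := by
  have hdV : Differentiable ℝ V := hV.differentiable (by norm_num)
  have hdF : Differentiable ℝ (fderiv ℝ V) :=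
    (hV.fderiv_right (m := 1) (by norm_num)).differentiable (by norm_num)
  have hline (r : ℝ) : HasDerivAt (fun r : ℝ => x + r • u) u r := by
    simpa using ((hasDerivAt_id r).smul_const u).const_add x
  have h1 (r : ℝ) : HasDerivAt (fun r : ℝ => V (x + r • u)) (fderiv ℝ V (x + r • u) u) r :=
    (hdV _).hasFDerivAt.comp_hasDerivAt r (hline r)
  have h2 (r : ℝ) : HasDerivAt (fun r : ℝ => fderiv ℝ V (x + r • u) u)
      (fderiv ℝ (fderiv ℝ V) (x + r • u) u u) r := by
    have := ((hdF _).hasFDerivAt.comp_hasDerivAt r (hline r)).clm_apply (hasDerivAt_const r u)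
    simpa using this
  have hslope (r : ℝ) (hr : 0 ≤ r) :
      fderiv ℝ V (x + r • u) u ≤ fderiv ℝ V x u + r * (β * ‖u‖ ^ 2) := by
    have hd (r : ℝ) : HasDerivAt (fun r : ℝ => r * (β * ‖u‖ ^ 2) - fderiv ℝ V (x + r • u) u)
        (1 * (β * ‖u‖ ^ 2) - fderiv ℝ (fderiv ℝ V) (x + r • u) u u) r :=
      ((hasDerivAt_id r).mul_const _).sub (h2 r)
    have hmono := monotone_of_hasDerivAt_nonneg hd (fun r => by
      have := hhess (x + r • u) u
      rw [iteratedFDeriv_two_apply] at this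
      simp at this ⊢
      linarith)
    have := hmono hr
    simp at this
    linarith
  have hd (r : ℝ) : HasDerivAt
      (fun r : ℝ => r * fderiv ℝ V x u + r ^ 2 * (β / 2 * ‖u‖ ^ 2) - V (x + r • u))
      (1 * fderiv ℝ V x u + (2 * r) * (β / 2 * ‖u‖ ^ 2) - fderiv ℝ V (x + r • u) u) r := by
    exact ((((hasDerivAt_id r).mul_const (fderiv ℝ V x u)).add
      ((hasDerivAt_pow 2 r).mul_const (β / 2 * ‖u‖ ^ 2))).sub (h1 r)).congr_deriv (by simp)
  have hmono := monotoneOn_of_hasDerivWithinAt_nonneg (convex_Ici (0 : ℝ))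
    (fun r _ => (hd r).continuousAt.continuousWithinAt)
    (fun r _ => (hd r).hasDerivWithinAt) (fun r hr => by
      have hr0 : 0 ≤ r := interior_subset hr
      have := hslope r hr0
      linarith)
  have := hmono (Set.mem_Ici.2 le_rfl) (Set.mem_Ici.2 zero_le_one) zero_le_one
  simp at this
  linarith

theorem integrable_exp_neg_mul_sq_norm_sub {d : ℕ} {b : ℝ} (hb : 0 < b)
    (c : EuclideanSpace ℝ (Fin d)) :
    Integrable fun y : EuclideanSpace ℝ (Fin d) => exp (-b * ‖y - c‖ ^ 2) := by
  have h : Integrable fun y : EuclideanSpace ℝ (Fin d) => exp (-b * ‖y‖ ^ 2) := by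
    have := (GaussianFourier.integrable_cexp_neg_mul_sq_norm_add (b := (b : ℂ))
      (by simpa using hb) 0 (0 : EuclideanSpace ℝ (Fin d))).norm
    refine this.congr (.of_forall fun y => ?_)
    simp only [Complex.norm_exp]
    norm_cast
    simp
  exact h.comp_sub_right c

theorem integral_exp_neg_mul_sq_norm_sub {d : ℕ} {b : ℝ} (hb : 0 < b)
    (c : EuclideanSpace ℝ (Fin d)) :
    ∫ y : EuclideanSpace ℝ (Fin d), exp (-b * ‖y - c‖ ^ 2) = (π / b) ^ ((d : ℝ) / 2) := by
  rw [integral_sub_right_eq_self (fun y : EuclideanSpace ℝ (Fin d) => exp (-b * ‖y‖ ^ 2)) c,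
    GaussianFourier.integral_rexp_neg_mul_sq_norm hb]
  simp

section Posterior

variable {d : ℕ} {V : EuclideanSpace ℝ (Fin d) → ℝ} {a s : ℝ}

theorem integrable_gaussian_mul {f : EuclideanSpace ℝ (Fin d) → ℝ}
    (hf : Integrable f) (hs : 0 < s) (z : EuclideanSpace ℝ (Fin d)) :
    Integrable fun x => exp (-‖z - a • x‖ ^ 2 / (2 * s)) * f x := by
  refine hf.bdd_mul (c := 1) (by fun_prop) (.of_forall fun x => ?_)
  rw [norm_of_nonneg (exp_pos _).le, exp_le_one_iff]
  exact div_nonpos_of_nonpos_of_nonneg (by simp) (by positivity)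

/-- Gaussian upper bound for the density at `x` of the posterior
`∝ exp (-‖z - a • x‖² / (2s) - V x)`. -/
theorem posterior_density_le (hV : ContDiff ℝ 2 V)
    (hint : Integrable fun x => exp (-V x)) {β : ℝ} (hβ : 0 ≤ β)
    (hhess : ∀ x v : EuclideanSpace ℝ (Fin d), iteratedFDeriv ℝ 2 V x ![v, v] ≤ β * ‖v‖ ^ 2)
    (ha : 0 < a) (hs : 0 < s) (z x : EuclideanSpace ℝ (Fin d)) :
    exp (-‖z - a • x‖ ^ 2 / (2 * s)) * exp (-V x) /
        ∫ y, exp (-‖z - a • y‖ ^ 2 / (2 * s)) * exp (-V y) ≤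
      (π / ((β + a ^ 2 / s) / 2)) ^ (-(d : ℝ) / 2) *
        exp (-(a ^ 2 / (2 * s ^ 2 * (β + a ^ 2 / s))) *
          ‖z - (a • x + (s / a) • gradient V x)‖ ^ 2) := by
  set l := β + a ^ 2 / s with hl
  have hl0 : 0 < l := by positivity
  set g := gradient V x
  set w := (a / s) • (z - a • x) - g with hw
  have hwn : a ^ 2 / (2 * s ^ 2 * l) * ‖z - (a • x + (s / a) • g)‖ ^ 2 = ‖w‖ ^ 2 / (2 * l) := by
    have : w = (a / s) • (z - (a • x + (s / a) • g)) := by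
      rw [hw, ← sub_sub, smul_sub (a / s) (z - a • x), smul_smul]
      field_simp
      simp
    rw [this, norm_smul, norm_of_nonneg (by positivity)]
    field_simp
  have hpt (y : EuclideanSpace ℝ (Fin d)) :
      exp (-‖z - a • x‖ ^ 2 / (2 * s)) * exp (-V x) * exp (‖w‖ ^ 2 / (2 * l)) *
          exp (-(l / 2) * ‖y - (x + l⁻¹ • w)‖ ^ 2) ≤
        exp (-‖z - a • y‖ ^ 2 / (2 * s)) * exp (-V y) := by
    simp only [← exp_add]
    refine exp_le_exp.2 ?_
    have hT := le_quadratic_of_iteratedFDeriv_two_le hV hhess x (y - x)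
    have hg : fderiv ℝ V x (y - x) = ⟪g, y - x⟫ := by
      simp [g, gradient]
    rw [hg] at hT
    set u := y - x with hu
    set e := z - a • x with he
    have e0 : x + u = y := by simp [hu]
    have e1 : z - a • y = e - a • u := by rw [he, hu, smul_sub]; abel
    have e2 : y - (x + l⁻¹ • w) = u - l⁻¹ • w := by rw [hu]; abel
    rw [e0] at hT
    rw [e1, e2, norm_sub_sq_real e (a • u), norm_sub_sq_real u]
    have e3 : ⟪u, w⟫ = a / s * ⟪e, u⟫ - ⟪g, u⟫ := by
      rw [hw, inner_sub_right, inner_smul_right, real_inner_comm e u, real_inner_comm g u]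
    rw [inner_smul_right, inner_smul_right, e3, norm_smul, norm_smul, norm_of_nonneg ha.le,
      norm_of_nonneg (inv_pos.2 hl0).le]
    have key : -‖e‖ ^ 2 / (2 * s) + -V x + ‖w‖ ^ 2 / (2 * l) +
        -(l / 2) * (‖u‖ ^ 2 - 2 * (l⁻¹ * (a / s * ⟪e, u⟫ - ⟪g, u⟫)) + (l⁻¹ * ‖w‖) ^ 2) =
        -(‖e‖ ^ 2 - 2 * (a * ⟪e, u⟫) + (a * ‖u‖) ^ 2) / (2 * s) -
          (V x + ⟪g, u⟫ + β / 2 * ‖u‖ ^ 2) := by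
      have h1 : -(l / 2) * (‖u‖ ^ 2 - 2 * (l⁻¹ * (a / s * ⟪e, u⟫ - ⟪g, u⟫)) + (l⁻¹ * ‖w‖) ^ 2) =
        -(l / 2) * ‖u‖ ^ 2 + (a / s * ⟪e, u⟫ - ⟪g, u⟫) - ‖w‖ ^ 2 / (2 * l) := by
        field_simp
        ring
      rw [h1, hl]
      field_simp
      ring
    linarith
  have hle := integral_mono
    ((integrable_exp_neg_mul_sq_norm_sub (half_pos hl0) (x + l⁻¹ • w)).const_mul
      (exp (-‖z - a • x‖ ^ 2 / (2 * s)) * exp (-V x) * exp (‖w‖ ^ 2 / (2 * l))))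
    (integrable_gaussian_mul (a := a) hint hs z) hpt
  rw [integral_const_mul, integral_exp_neg_mul_sq_norm_sub (half_pos hl0)] at hle
  have hpos : 0 < π / (l / 2) := by positivity
  rw [div_le_iff₀ (lt_of_lt_of_le (by positivity) hle), neg_mul, hwn]
  refine le_trans (le_of_eq ?_) (mul_le_mul_of_nonneg_left hle (by positivity))
  have h1 : (π / (l / 2)) ^ (-(d : ℝ) / 2) * (π / (l / 2)) ^ ((d : ℝ) / 2) = 1 := by
    rw [← rpow_add hpos, neg_div, neg_add_cancel, rpow_zero]
  have h2 : exp (-(‖w‖ ^ 2 / (2 * l))) * exp (‖w‖ ^ 2 / (2 * l)) = 1 := by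
    rw [← exp_add, neg_add_cancel, exp_zero]
  linear_combination (-(exp (-‖z - a • x‖ ^ 2 / (2 * s)) * exp (-V x))) *
    ((π / (l / 2)) ^ (-(d : ℝ) / 2) * (π / (l / 2)) ^ ((d : ℝ) / 2) * h2 + h1)

/-- The total mass in `z` of the Gaussian bound of `posterior_density_le`. -/
theorem lintegral_gaussian_bound {β : ℝ} (hβ : 0 ≤ β) (ha : 0 < a) (hs : 0 < s)
    (c : EuclideanSpace ℝ (Fin d)) :
    ∫⁻ z, ENNReal.ofReal ((π / ((β + a ^ 2 / s) / 2)) ^ (-(d : ℝ) / 2) *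
        exp (-(a ^ 2 / (2 * s ^ 2 * (β + a ^ 2 / s))) * ‖z - c‖ ^ 2)) =
      ENNReal.ofReal (a⁻¹ ^ d * (β * s + a ^ 2) ^ d) := by
  have hl0 : 0 < β + a ^ 2 / s := by positivity
  have hb : 0 < a ^ 2 / (2 * s ^ 2 * (β + a ^ 2 / s)) := by positivity
  rw [← ofReal_integral_eq_lintegral_ofReal
    ((integrable_exp_neg_mul_sq_norm_sub hb c).const_mul _)
    (.of_forall fun z => by positivity), integral_const_mul, integral_exp_neg_mul_sq_norm_sub hb,
    neg_div, rpow_neg (by positivity), ← inv_rpow (by positivity),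
    ← mul_rpow (by positivity) (by positivity), ← mul_pow]
  congr 1
  have : (π / ((β + a ^ 2 / s) / 2))⁻¹ * (π / (a ^ 2 / (2 * s ^ 2 * (β + a ^ 2 / s)))) =
      (a⁻¹ * (β * s + a ^ 2)) ^ (2 : ℝ) := by
    rw [rpow_two]
    field_simp
  rw [this, ← rpow_mul (by positivity), mul_div_cancel₀ _ two_ne_zero, rpow_natCast]

theorem lintegral_posterior_ratio_le (hV : ContDiff ℝ 2 V)
    (hint : Integrable fun x => exp (-V x)) (hint2 : Integrable fun x => exp (-(2 * V x)))
    {β : ℝ} (hβ : 0 ≤ β)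
    (hhess : ∀ x v : EuclideanSpace ℝ (Fin d), iteratedFDeriv ℝ 2 V x ![v, v] ≤ β * ‖v‖ ^ 2)
    (ha : 0 < a) (hs : 0 < s) :
    ∫⁻ z, ENNReal.ofReal ((∫ x, exp (-‖z - a • x‖ ^ 2 / (2 * s)) * exp (-(2 * V x))) /
        ∫ x, exp (-‖z - a • x‖ ^ 2 / (2 * s)) * exp (-V x)) ≤
      ENNReal.ofReal ((∫ x, exp (-V x)) * (a⁻¹ ^ d * (β * s + a ^ 2) ^ d)) := by
  set G : EuclideanSpace ℝ (Fin d) → EuclideanSpace ℝ (Fin d) → ℝ := fun z x =>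
    (π / ((β + a ^ 2 / s) / 2)) ^ (-(d : ℝ) / 2) *
        exp (-(a ^ 2 / (2 * s ^ 2 * (β + a ^ 2 / s))) *
          ‖z - (a • x + (s / a) • gradient V x)‖ ^ 2) with hG
  have hVc : Continuous V := hV.continuous
  have hgrad : Continuous (gradient V) :=
    (InnerProductSpace.toDual ℝ (EuclideanSpace ℝ (Fin d))).symm.continuous.comp
      (hV.continuous_fderiv (by norm_num))
  have hGc : Continuous (Function.uncurry G) := by
    simp only [hG, Function.uncurry_def]
    fun_prop
  calc
    _ ≤ ∫⁻ z, ∫⁻ x, ENNReal.ofReal (exp (-V x)) * ENNReal.ofReal (G z x) := by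
      refine lintegral_mono fun z => ?_
      rw [← integral_div, ofReal_integral_eq_lintegral_ofReal
        ((integrable_gaussian_mul hint2 hs z).div_const _)
        (.of_forall fun x => div_nonneg (by positivity)
          (integral_nonneg fun x => by positivity))]
      refine lintegral_mono fun x => ?_
      rw [← ENNReal.ofReal_mul (exp_pos _).le]
      refine ENNReal.ofReal_le_ofReal ?_
      refine le_trans (le_of_eq ?_) (mul_le_mul_of_nonneg_left
        (posterior_density_le hV hint hβ hhess ha hs z x) (exp_pos (-V x)).le)
      rw [show -(2 * V x) = -V x + -V x by ring, exp_add]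
      ring
    _ = ∫⁻ x, ∫⁻ z, ENNReal.ofReal (exp (-V x)) * ENNReal.ofReal (G z x) := by
      refine lintegral_lintegral_swap (Measurable.aemeasurable ?_)
      refine Measurable.mul ?_ hGc.measurable.ennreal_ofReal
      exact Measurable.ennreal_ofReal (Continuous.measurable (by fun_prop))
    _ = ∫⁻ x, ENNReal.ofReal (exp (-V x)) *
          ENNReal.ofReal (a⁻¹ ^ d * (β * s + a ^ 2) ^ d) := by
      refine lintegral_congr fun x => ?_
      rw [lintegral_const_mul' _ _ ENNReal.ofReal_ne_top]
      exact congrArg _ (lintegral_gaussian_bound hβ ha hs _)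
    _ = _ := by
      rw [lintegral_mul_const' _ _ ENNReal.ofReal_ne_top,
        ← ofReal_integral_eq_lintegral_ofReal hint (.of_forall fun x => (exp_pos _).le),
        ENNReal.ofReal_mul (integral_nonneg fun x => (exp_pos _).le)]

end Posterior

/-- For `μ = e^{-V}/Z_V` `β`-semi-log-convex with finite second moment, the
zeroth moment of the ratio `Φ_t = p_t^{2V}/p_t^V` of forward OU densities satisfies, for `t > 0`,
`m_0(Φ_t) = ∫ Φ_t(z) dz ≤ (Z_V²/Z_{2V}) e^{td} (β(1-e^{-2t}) + e^{-2t})^d`. -/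
theorem ratio_zeroth_moment_bound
    (d : ℕ) (hd : 1 ≤ d) (V : EuclideanSpace ℝ (Fin d) → ℝ)
    (hV : ContDiff ℝ 2 V)
    (hint : Integrable fun x : EuclideanSpace ℝ (Fin d) => exp (-V x))
    (hint2 : Integrable fun x : EuclideanSpace ℝ (Fin d) => exp (-(2 * V x)))
    (hm2 : Integrable fun x : EuclideanSpace ℝ (Fin d) => ‖x‖ ^ 2 * exp (-V x))
    (β : ℝ) (hβ : 0 ≤ β)
    (hhess : ∀ x v : EuclideanSpace ℝ (Fin d),
      iteratedFDeriv ℝ 2 V x ![v, v] ≤ β * ‖v‖ ^ 2)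
    (t : ℝ) (ht : 0 < t) :
    ∫⁻ z : EuclideanSpace ℝ (Fin d),
        ENNReal.ofReal (ouDensity d (fun x => 2 * V x) t z / ouDensity d V t z) ≤
      ENNReal.ofReal
        (((∫ x : EuclideanSpace ℝ (Fin d), exp (-V x)) ^ 2 /
            ∫ x : EuclideanSpace ℝ (Fin d), exp (-(2 * V x))) *
          exp (t * d) * (β * (1 - exp (-2 * t)) + exp (-2 * t)) ^ d) := by
  have hs : 0 < 1 - exp (-2 * t) := by
    rw [sub_pos, exp_lt_one_iff]
    linarith
  have hZ : 0 < ∫ x, exp (-V x) := integral_exp_pos hint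
  have hZ2 : 0 < ∫ x, exp (-(2 * V x)) := integral_exp_pos hint2
  have hc : 0 < (2 * π * (1 - exp (-2 * t))) ^ (-(d : ℝ) / 2) := by positivity
  have hsq : exp (-t) ^ 2 = exp (-2 * t) := by
    rw [← exp_nat_mul]
    congr 1
    push_cast
    ring
  have hinv : (exp (-t))⁻¹ ^ d = exp (t * d) := by
    rw [← exp_neg, neg_neg, ← exp_nat_mul, mul_comm]
  have hratio (z : EuclideanSpace ℝ (Fin d)) :
      ouDensity d (fun x => 2 * V x) t z / ouDensity d V t z =
        (∫ x, exp (-V x)) / (∫ x, exp (-(2 * V x))) *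
          ((∫ x, exp (-‖z - exp (-t) • x‖ ^ 2 / (2 * (1 - exp (-2 * t)))) * exp (-(2 * V x))) /
            ∫ x, exp (-‖z - exp (-t) • x‖ ^ 2 / (2 * (1 - exp (-2 * t)))) * exp (-V x)) := by
    simp only [ouDensity, ← mul_div_assoc, integral_div]
    generalize (2 * π * (1 - exp (-2 * t))) ^ (-(d : ℝ) / 2) = c at hc
    field_simp
  simp only [hratio, ENNReal.ofReal_mul (div_pos hZ hZ2).le]
  rw [lintegral_const_mul' _ _ ENNReal.ofReal_ne_top]
  refine (mul_le_mul_right (lintegral_posterior_ratio_le hV hint hint2 hβ hhess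
    (exp_pos (-t)) hs) _).trans (le_of_eq ?_)
  rw [← ENNReal.ofReal_mul (div_pos hZ hZ2).le, hsq, hinv]
  congr 1
  ring
end
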